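/- arXiv:2602.07385 — 9 statements merged into one kernel-verified Lean document; each statement's English description precedes it below -/
import Mathlib

section
/- Let T and U be disjoint finite sets of agents, where every agent of T has quality f_i/α_i ≥ q, every agent of U has quality exactly q (i.e., f_i = q·α_i for i ∈ U), and let 0 < q′ ≤ q. Then (1/2)·(1 + α(T ∪ U) − f(T ∪ U)/q′) ≤ (1/2)·(1 + α(T) − f(T)/q). Consequently, in the additive OMAC setup, for every S ⊆ N and every 1 ≤ x < p, the balance points satisfy b(S, x) ≥ b(S, x+1). -/
open Finset

/-- Total share `α(S)` of a team `S`. -/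
def shareSum {ι : Type} (a : ι → ℝ) (S : Finset ι) : ℝ := ∑ i ∈ S, a i

/-- Total value `f(S)` of a team `S` (additive reward). -/
def valSum {ι : Type} (f : ι → ℝ) (S : Finset ι) : ℝ := ∑ i ∈ S, f i

/-- `S^{x-1}`: the agents of `S` belonging to quality groups strictly before `x`. -/
def belowSet {ι : Type} [DecidableEq ι] {p : ℕ} (grp : ι → Fin p) (S : Finset ι)
    (x : Fin p) : Finset ι :=
  S.filter (fun i => grp i < x)

/-- The balance point `b(S,x) = (1/2)·(1 + α(S^{x−1}) − f(S^{x−1})/q^x)`. -/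
noncomputable def balPt {ι : Type} [DecidableEq ι] {p : ℕ} (f a : ι → ℝ)
    (grp : ι → Fin p) (qv : Fin p → ℝ) (S : Finset ι) (x : Fin p) : ℝ :=
  (1 / 2) * (1 + shareSum a (belowSet grp S x) - valSum f (belowSet grp S x) / qv x)

/-- Adding agents `U` of quality exactly `q` to a team `T` of quality at least `q`, and lowering
the reference quality from `q` to `q'`, does not increase the balance point. -/
theorem balance_union_le {ι : Type} [DecidableEq ι] {f a : ι → ℝ} {T U : Finset ι} {q q' : ℝ}
    (hTU : Disjoint T U) (haT : ∀ i ∈ T, 0 ≤ a i) (haU : ∀ i ∈ U, 0 ≤ a i)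
    (hT : ∀ i ∈ T, q * a i ≤ f i) (hU : ∀ i ∈ U, f i = q * a i) (hq' : 0 < q') (hq : q' ≤ q) :
    (1 / 2) * (1 + shareSum a (T ∪ U) - valSum f (T ∪ U) / q') ≤
      (1 / 2) * (1 + shareSum a T - valSum f T / q) := by
  have hq0 : 0 ≤ q := hq'.le.trans hq
  have hvalT : 0 ≤ valSum f T :=
    sum_nonneg fun i hi => (mul_nonneg hq0 (haT i hi)).trans (hT i hi)
  have hshareU : 0 ≤ shareSum a U := sum_nonneg haU
  have hvalU : valSum f U = q * shareSum a U := by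
    simp only [valSum, shareSum, mul_sum]
    exact sum_congr rfl hU
  have hshare : shareSum a (T ∪ U) = shareSum a T + shareSum a U := sum_union hTU
  have hval : valSum f (T ∪ U) = valSum f T + valSum f U := sum_union hTU
  have hdivT : valSum f T / q ≤ valSum f T / q' := div_le_div_of_nonneg_left hvalT hq' hq
  have hdivU : shareSum a U ≤ valSum f U / q' := by
    rw [le_div_iff₀ hq', hvalU, mul_comm]
    exact mul_le_mul_of_nonneg_right hq hshareU
  rw [hshare, hval, add_div]
  linarith

/-- Let `T` and `U` be disjoint finite sets of agents, where every
agent of `T` has quality `f_i/α_i ≥ q`, every agent of `U` has quality exactly `q`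
(i.e. `f_i = q·α_i` for `i ∈ U`), and let `0 < q′ ≤ q`. Then
`(1/2)·(1 + α(T ∪ U) − f(T ∪ U)/q′) ≤ (1/2)·(1 + α(T) − f(T)/q)`.
Consequently, in the additive OMAC setup, for every `S ⊆ N` and every
`1 ≤ x < p`, the balance points satisfy `b(S, x) ≥ b(S, x+1)`. -/
theorem balance_points_nonincreasing {ι : Type} [DecidableEq ι]
    (N : Finset ι) (f a : ι → ℝ) (p : ℕ) (qv : Fin p → ℝ) (grp : ι → Fin p)
    (hf : ∀ i ∈ N, 0 < f i) (ha : ∀ i ∈ N, 0 < a i)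
    (hqv : ∀ x, 0 < qv x) (hanti : StrictAnti qv)
    (hqual : ∀ i ∈ N, f i = qv (grp i) * a i) :
    (∀ (T U : Finset ι) (q q' : ℝ), Disjoint T U →
      (∀ i ∈ T, 0 < a i) → (∀ i ∈ U, 0 < a i) →
      (∀ i ∈ T, q * a i ≤ f i) → (∀ i ∈ U, f i = q * a i) →
      0 < q' → q' ≤ q →
      (1 / 2) * (1 + shareSum a (T ∪ U) - valSum f (T ∪ U) / q') ≤
        (1 / 2) * (1 + shareSum a T - valSum f T / q))
    ∧ (∀ S : Finset ι, S ⊆ N → ∀ x y : Fin p, (x : ℕ) + 1 = (y : ℕ) →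
        balPt f a grp qv S y ≤ balPt f a grp qv S x) := by
  refine ⟨fun T U q q' hTU haT haU hT hU hq' hq =>
    balance_union_le hTU (fun i hi => (haT i hi).le) (fun i hi => (haU i hi).le) hT hU hq' hq, ?_⟩
  intro S hS x y hxy
  have hsplit : belowSet grp S y = belowSet grp S x ∪ S.filter (fun i => grp i = x) := by
    rw [belowSet, belowSet, ← filter_or]
    refine filter_congr fun i _ => ?_
    rw [Fin.lt_def, Fin.lt_def, Fin.ext_iff]
    omega
  have hxy' : x < y := by
    rw [Fin.lt_def]
    omega
  rw [balPt, balPt, hsplit]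
  refine balance_union_le (disjoint_filter.2 fun i _ hlt => hlt.ne)
    (fun i hi => (ha i (hS (mem_filter.1 hi).1)).le)
    (fun i hi => (ha i (hS (mem_filter.1 hi).1)).le) (fun i hi => ?_) (fun i hi => ?_)
    (hqv y) (hanti hxy').le
  · obtain ⟨hiS, hlt⟩ := mem_filter.1 hi
    rw [hqual i (hS hiS)]
    exact mul_le_mul_of_nonneg_right (hanti hlt).le (ha i (hS hiS)).le
  · obtain ⟨hiS, heq⟩ := mem_filter.1 hi
    rw [hqual i (hS hiS), heq]
end

section
/- Let S ⊆ N be a finite set of agents in the additive OMAC setup, and let i ∈ S be the first agent (in the ordering of S by decreasing quality, ties broken by nondecreasing share) belonging to quality group Q_x such that α(S̄_i) ≥ b(S, x). Then g(S̄_i) ≥ g(S). -/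
open Finset

/-- The principal's utility `g(S) = (1 − α(S))·f(S)`. -/
def gUtil {ι : Type} (f a : ι → ℝ) (S : Finset ι) : ℝ :=
  (1 - shareSum a S) * valSum f S

/-- Enlarging a team `(A, F)` by agents of total share `r` and total value `v ≤ q * r` does not
raise the utility once `q * (1 - A) ≤ F`. -/
theorem utility_add_le {A F r v q : ℝ} (hF : 0 ≤ F) (hr : 0 ≤ r) (hv : 0 ≤ v)
    (hq : 0 ≤ q) (hvr : v ≤ q * r) (hAF : q * (1 - A) ≤ F) :
    (1 - (A + r)) * (F + v) ≤ (1 - A) * F := by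
  rcases le_total 0 (1 - (A + r)) with h | h
  · nlinarith [mul_le_mul_of_nonneg_left hvr h, mul_nonneg hr (sub_nonneg.2 hAF),
      mul_nonneg hq (mul_nonneg hr hr)]
  · nlinarith [mul_nonneg (neg_nonneg.2 h) hv, mul_nonneg hr hF]

/-- In a list sorted by group, the entries up to the `k`-th have group at most that of the
`k`-th entry. -/
theorem grp_le_of_mem_take {ι β : Type*} [Preorder β] {grp : ι → β} {L : List ι}
    (hL : L.Pairwise (fun i j => grp i ≤ grp j)) {k : ℕ} (hk : k < L.length) {i : ι}
    (hi : i ∈ L.take (k + 1)) : grp i ≤ grp L[k] := by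
  obtain ⟨j, hj, rfl⟩ := List.mem_take_iff_getElem.1 hi
  rcases (show j ≤ k by omega).eq_or_lt with rfl | h
  · exact le_rfl
  · exact List.pairwise_iff_getElem.1 hL j k _ hk h

/-- In a list sorted by group, the entries after the `k`-th have group at least that of the
`k`-th entry. -/
theorem grp_le_of_mem_drop {ι β : Type*} [Preorder β] {grp : ι → β} {L : List ι}
    (hL : L.Pairwise (fun i j => grp i ≤ grp j)) {k : ℕ} (hk : k < L.length) {i : ι}
    (hi : i ∈ L.drop (k + 1)) : grp L[k] ≤ grp i := by
  obtain ⟨j, hj, rfl⟩ := List.mem_drop_iff_getElem.1 hi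
  exact List.pairwise_iff_getElem.1 hL k _ hk _ (by omega)

/-- Let `S ⊆ N` be a finite set of agents in the additive OMAC setup,
and let `i ∈ S` be the first agent (in the ordering of `S` by decreasing quality,
ties broken by nondecreasing share) belonging to quality group `Q_x` such that
`α(S̄_i) ≥ b(S, x)`. Then `g(S̄_i) ≥ g(S)`.

The ordering of `S` is represented by a list `L` enumerating `S`, sorted so that
earlier agents have strictly higher quality (i.e. smaller group index), with ties
broken by nondecreasing share; the agent `i` is the `k`-th entry, `S̄_i` is the set
of entries up to and including `i`, and `i` is the first entry whose prefix crosses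
its balance point. -/
theorem crossing_balance_point {ι : Type} [DecidableEq ι]
    (N : Finset ι) (f a : ι → ℝ) (p : ℕ) (qv : Fin p → ℝ) (grp : ι → Fin p)
    (hf : ∀ i ∈ N, 0 < f i) (ha : ∀ i ∈ N, 0 < a i)
    (hqv : ∀ x, 0 < qv x) (hanti : StrictAnti qv)
    (hqual : ∀ i ∈ N, f i = qv (grp i) * a i)
    (S : Finset ι) (hS : S ⊆ N)
    (L : List ι) (hnd : L.Nodup) (hLS : L.toFinset = S)
    (hsort : L.Pairwise (fun i j => grp i < grp j ∨ (grp i = grp j ∧ a i ≤ a j)))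
    (k : ℕ) (hk : k < L.length)
    (hcross : balPt f a grp qv S (grp (L.get ⟨k, hk⟩)) ≤
      shareSum a ((L.take (k + 1)).toFinset))
    (hfirst : ∀ (j : ℕ) (hj : j < k),
      shareSum a ((L.take (j + 1)).toFinset) <
        balPt f a grp qv S (grp (L.get ⟨j, hj.trans hk⟩))) :
    gUtil f a S ≤ gUtil f a ((L.take (k + 1)).toFinset) := by
  have hgrp : L.Pairwise (fun i j => grp i ≤ grp j) :=
    hsort.imp fun h => h.elim le_of_lt fun h => h.1.le
  simp only [List.get_eq_getElem] at hcross
  set x := grp L[k]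
  set T := (L.take (k + 1)).toFinset with hT
  set B := belowSet grp S x with hB
  have hTS : T ⊆ S := fun i hi => by
    rw [← hLS, List.mem_toFinset]
    exact List.mem_of_mem_take (List.mem_toFinset.1 hi)
  have hTx : ∀ i ∈ T, grp i ≤ x := fun i hi =>
    grp_le_of_mem_take hgrp hk (List.mem_toFinset.1 hi)
  have hRx : ∀ i ∈ S \ T, x ≤ grp i := fun i hi => by
    rw [mem_sdiff, ← hLS, hT, List.mem_toFinset, List.mem_toFinset,
      ← List.take_append_drop (k + 1) L, List.mem_append] at hi
    simp only [List.take_append_drop] at hi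
    exact grp_le_of_mem_drop hgrp hk (hi.1.resolve_left hi.2)
  have hBT : B ⊆ T := fun i hi => by
    obtain ⟨hiS, hix⟩ := mem_filter.1 hi
    by_contra hiT
    exact (hRx i (mem_sdiff.2 ⟨hiS, hiT⟩)).not_gt hix
  have hSsum (h : ι → ℝ) : ∑ i ∈ S, h i = ∑ i ∈ T, h i + ∑ i ∈ S \ T, h i := by
    rw [add_comm, sum_sdiff hTS]
  have hTsum (h : ι → ℝ) : ∑ i ∈ T, h i = ∑ i ∈ B, h i + ∑ i ∈ T \ B, h i := by
    rw [add_comm, sum_sdiff hBT]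
  have hRN : ∀ i ∈ S \ T, i ∈ N := fun i hi => hS (mem_sdiff.1 hi).1
  have hmid : ∑ i ∈ T \ B, f i = qv x * ∑ i ∈ T \ B, a i := by
    rw [mul_sum]
    refine sum_congr rfl fun i hi => ?_
    obtain ⟨hiT, hiB⟩ := mem_sdiff.1 hi
    have hix : grp i = x := (hTx i hiT).eq_of_not_lt fun h =>
      hiB (mem_filter.2 ⟨hTS hiT, h⟩)
    rw [hqual i (hS (hTS hiT)), hix]
  have hrest : ∑ i ∈ S \ T, f i ≤ qv x * ∑ i ∈ S \ T, a i := by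
    rw [mul_sum]
    refine sum_le_sum fun i hi => ?_
    rw [hqual i (hRN i hi)]
    exact mul_le_mul_of_nonneg_right (hanti.antitone (hRx i hi)) (ha i (hRN i hi)).le
  have hq := hqv x
  simp only [gUtil, balPt, shareSum, valSum] at hcross ⊢
  rw [hSsum f, hSsum a]
  refine utility_add_le (sum_nonneg fun i hi => (hf i (hS (hTS hi))).le)
    (sum_nonneg fun i hi => (ha i (hRN i hi)).le)
    (sum_nonneg fun i hi => (hf i (hRN i hi)).le) hq.le hrest ?_
  have hcross' := mul_le_mul_of_nonneg_left hcross hq.le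
  rw [← hB] at hcross'
  have hdiv : qv x * ((∑ i ∈ B, f i) / qv x) = ∑ i ∈ B, f i := mul_div_cancel₀ _ hq.ne'
  rw [hTsum f, hmid]
  rw [hTsum a] at hcross' ⊢
  linarith
end

section
/- Let S, S′ ⊆ N be two sets of agents in the additive OMAC setup, and let 1 ≤ z ≤ p be an index such that for every quality group Q_x with 1 ≤ x ≤ z, the shares satisfy α(S ∩ Q_x) ≤ α(S′ ∩ Q_x). Then for all 1 ≤ x ≤ z, the balance points satisfy b(S, x) ≥ b(S′, x). -/
open Finset

/-- The balance point, written as a combination of the shares of the earlier quality groups. -/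
theorem balPt_eq_sum_groups {ι : Type} [DecidableEq ι] {p : ℕ} (f a : ι → ℝ)
    (grp : ι → Fin p) (qv : Fin p → ℝ) (S : Finset ι)
    (hqual : ∀ i ∈ S, f i = qv (grp i) * a i) (x : Fin p) :
    balPt f a grp qv S x = (1 / 2) * (1 + ∑ y ∈ Finset.Iio x,
      (1 - qv y / qv x) * shareSum a (S.filter (fun i => grp i = y))) := by
  have hmaps : ∀ i ∈ belowSet grp S x, grp i ∈ Finset.Iio x := fun i hi =>
    Finset.mem_Iio.2 (Finset.mem_filter.1 hi).2
  have hsum : shareSum a (belowSet grp S x) - valSum f (belowSet grp S x) / qv x =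
      ∑ y ∈ Finset.Iio x,
        (1 - qv y / qv x) * shareSum a (S.filter (fun i => grp i = y)) := by
    unfold shareSum valSum
    rw [Finset.sum_div, ← Finset.sum_sub_distrib, ← Finset.sum_fiberwise_of_maps_to hmaps]
    refine Finset.sum_congr rfl fun y hy => ?_
    have hfiber : (belowSet grp S x).filter (fun i => grp i = y) =
        S.filter (fun i => grp i = y) := by
      ext i
      have := Finset.mem_Iio.1 hy
      simp only [belowSet, Finset.mem_filter]
      grind
    rw [hfiber, Finset.mul_sum]
    refine Finset.sum_congr rfl fun i hi => ?_
    obtain ⟨hiS, rfl⟩ := Finset.mem_filter.1 hi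
    rw [hqual i hiS]
    ring
  rw [balPt, add_sub_assoc, hsum]

/-- Let `S, S′ ⊆ N` be two sets of agents in the additive OMAC setup,
and let `1 ≤ z ≤ p` be an index such that for every quality group `Q_x` with
`1 ≤ x ≤ z` the shares satisfy `α(S ∩ Q_x) ≤ α(S′ ∩ Q_x)`. Then for all
`1 ≤ x ≤ z` the balance points satisfy `b(S, x) ≥ b(S′, x)`. -/
theorem balance_points_monotone {ι : Type} [DecidableEq ι]
    (N : Finset ι) (f a : ι → ℝ) (p : ℕ) (qv : Fin p → ℝ) (grp : ι → Fin p)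
    (hf : ∀ i ∈ N, 0 < f i) (ha : ∀ i ∈ N, 0 < a i)
    (hqv : ∀ x, 0 < qv x) (hanti : StrictAnti qv)
    (hqual : ∀ i ∈ N, f i = qv (grp i) * a i)
    (S S' : Finset ι) (hS : S ⊆ N) (hS' : S' ⊆ N)
    (z : Fin p)
    (hsh : ∀ x : Fin p, x ≤ z →
      shareSum a (S.filter (fun i => grp i = x)) ≤
        shareSum a (S'.filter (fun i => grp i = x))) :
    ∀ x : Fin p, x ≤ z → balPt f a grp qv S' x ≤ balPt f a grp qv S x := by
  intro x hx
  rw [balPt_eq_sum_groups f a grp qv S (fun i hi => hqual i (hS hi)),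
    balPt_eq_sum_groups f a grp qv S' (fun i hi => hqual i (hS' hi))]
  gcongr 1 / 2 * (1 + ?_)
  refine Finset.sum_le_sum fun y hy => ?_
  have hyx : y < x := Finset.mem_Iio.1 hy
  refine mul_le_mul_of_nonpos_left (hsh y (hyx.le.trans hx)) ?_
  rw [sub_nonpos, one_le_div (hqv x)]
  exact (hanti hyx).le
end

section
/- Let S, S′ ⊆ N be two sets of agents in the additive OMAC setup. Suppose that for every quality group Q_x with 1 ≤ x ≤ p, the shares satisfy α(S ∩ Q_x) ≤ α(S′ ∩ Q_x) and α(S^x) ≤ α((S′)^x) ≤ b(S′, x). Then the principal's utilities satisfy g(S) ≤ g(S′). -/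
open Finset

/-- `S^x`: the agents of `S` belonging to quality groups up to and including `x`. -/
def uptoSet {ι : Type} [DecidableEq ι] {p : ℕ} (grp : ι → Fin p) (S : Finset ι)
    (x : Fin p) : Finset ι :=
  S.filter (fun i => grp i ≤ x)

theorem shareSum_eq_sum_groups {ι : Type} {p : ℕ} (a : ι → ℝ) (grp : ι → Fin p)
    (S : Finset ι) :
    shareSum a S = ∑ x, shareSum a (S.filter (fun i => grp i = x)) :=
  (Finset.sum_fiberwise S grp a).symm

theorem valSum_group {ι : Type} {p : ℕ} {f a : ι → ℝ} {qv : Fin p → ℝ} {grp : ι → Fin p}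
    {S : Finset ι} (hqual : ∀ i ∈ S, f i = qv (grp i) * a i) (x : Fin p) :
    valSum f (S.filter (fun i => grp i = x)) =
      qv x * shareSum a (S.filter (fun i => grp i = x)) := by
  unfold valSum shareSum
  rw [Finset.mul_sum]
  refine Finset.sum_congr rfl fun i hi => ?_
  obtain ⟨hiS, rfl⟩ := Finset.mem_filter.mp hi
  exact hqual i hiS

theorem valSum_eq_sum_groups {ι : Type} {p : ℕ} {f a : ι → ℝ} {qv : Fin p → ℝ}
    {grp : ι → Fin p} {S : Finset ι} (hqual : ∀ i ∈ S, f i = qv (grp i) * a i) :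
    valSum f S = ∑ x, qv x * shareSum a (S.filter (fun i => grp i = x)) := by
  simp only [← valSum_group hqual]
  exact (Finset.sum_fiberwise S grp f).symm

theorem sum_uptoSet {ι : Type} [DecidableEq ι] {p : ℕ} (h : ι → ℝ) (grp : ι → Fin p)
    (S : Finset ι) (x : Fin p) :
    ∑ i ∈ uptoSet grp S x, h i =
      ∑ i ∈ belowSet grp S x, h i + ∑ i ∈ S.filter (fun i => grp i = x), h i := by
  unfold uptoSet belowSet
  rw [← Finset.sum_union (Finset.disjoint_filter.mpr fun i _ hlt heq => hlt.ne heq),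
    ← Finset.filter_or]
  simp only [le_iff_lt_or_eq]

theorem uptoSet_last {ι : Type} [DecidableEq ι] {n : ℕ} (grp : ι → Fin (n + 1))
    (S : Finset ι) : uptoSet grp S (Fin.last n) = S :=
  Finset.filter_true_of_mem fun i _ => Fin.le_last (grp i)

/-- Staying below the balance point of `Q_x` means `f(S^x) ≤ q^x (1 − α(S^x))`. -/
theorem valSum_uptoSet_le_of_le_balPt {ι : Type} [DecidableEq ι] {p : ℕ} {f a : ι → ℝ}
    {qv : Fin p → ℝ} {grp : ι → Fin p} {S : Finset ι} {x : Fin p} (hq : 0 < qv x)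
    (hqual : ∀ i ∈ S, f i = qv (grp i) * a i)
    (hb : shareSum a (uptoSet grp S x) ≤ balPt f a grp qv S x) :
    valSum f (uptoSet grp S x) ≤ qv x * (1 - shareSum a (uptoSet grp S x)) := by
  have hA : shareSum a (uptoSet grp S x) = shareSum a (belowSet grp S x) +
    shareSum a (S.filter (fun i => grp i = x)) := sum_uptoSet a grp S x
  have hF : valSum f (uptoSet grp S x) = valSum f (belowSet grp S x) +
    valSum f (S.filter (fun i => grp i = x)) := sum_uptoSet f grp S x
  rw [valSum_group hqual] at hF
  unfold balPt at hb
  have hdiv : valSum f (belowSet grp S x) / qv x ≤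
      1 + shareSum a (belowSet grp S x) - 2 * shareSum a (uptoSet grp S x) := by linarith
  rw [div_le_iff₀ hq] at hdiv
  rw [hF]
  rw [hA] at hdiv ⊢
  linarith

/-- If `f(S') ≤ q (1 − α(S'))` for every group quality `q`, lowering the share of each group
does not raise the utility. -/
theorem gUtil_le_of_group_shares_le {ι : Type} {p : ℕ} {f a : ι → ℝ} {qv : Fin p → ℝ}
    {grp : ι → Fin p} {S S' : Finset ι} (hq : ∀ x, 0 < qv x)
    (hqual : ∀ i ∈ S, f i = qv (grp i) * a i) (hqual' : ∀ i ∈ S', f i = qv (grp i) * a i)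
    (hsh : ∀ x, shareSum a (S.filter (fun i => grp i = x)) ≤
      shareSum a (S'.filter (fun i => grp i = x)))
    (hle : ∀ x, valSum f S' ≤ qv x * (1 - shareSum a S')) :
    gUtil f a S ≤ gUtil f a S' := by
  have hD : 0 ≤ shareSum a S' - shareSum a S := by
    rw [shareSum_eq_sum_groups a grp S, shareSum_eq_sum_groups a grp S']
    exact sub_nonneg.mpr (Finset.sum_le_sum fun x _ => hsh x)
  have hE : 0 ≤ valSum f S' - valSum f S := by
    rw [valSum_eq_sum_groups hqual, valSum_eq_sum_groups hqual']
    exact sub_nonneg.mpr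
      (Finset.sum_le_sum fun x _ => mul_le_mul_of_nonneg_left (hsh x) (hq x).le)
  have hDE : (shareSum a S' - shareSum a S) * valSum f S' ≤
      (valSum f S' - valSum f S) * (1 - shareSum a S') := by
    have hDsum : shareSum a S' - shareSum a S =
        ∑ x, (shareSum a (S'.filter (fun i => grp i = x)) -
          shareSum a (S.filter (fun i => grp i = x))) := by
      rw [Finset.sum_sub_distrib, ← shareSum_eq_sum_groups, ← shareSum_eq_sum_groups]
    have hEsum : valSum f S' - valSum f S =
        ∑ x, qv x * (shareSum a (S'.filter (fun i => grp i = x)) -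
          shareSum a (S.filter (fun i => grp i = x))) := by
      simp only [mul_sub]
      rw [Finset.sum_sub_distrib, ← valSum_eq_sum_groups hqual, ← valSum_eq_sum_groups hqual']
    rw [hDsum, hEsum, Finset.sum_mul, Finset.sum_mul]
    refine Finset.sum_le_sum fun x _ => ?_
    linarith [mul_le_mul_of_nonneg_left (hle x) (sub_nonneg.mpr (hsh x))]
  unfold gUtil
  linarith [mul_nonneg hD hE]

/-- Let `S, S′ ⊆ N` be two sets of agents in the additive OMAC setup.
Suppose that for every quality group `Q_x` with `1 ≤ x ≤ p`, the shares satisfy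
`α(S ∩ Q_x) ≤ α(S′ ∩ Q_x)` and `α(S^x) ≤ α((S′)^x) ≤ b(S′, x)`.
Then the principal's utilities satisfy `g(S) ≤ g(S′)`. -/
theorem utility_comparison_by_balance_points {ι : Type} [DecidableEq ι]
    (N : Finset ι) (f a : ι → ℝ) (p : ℕ) (qv : Fin p → ℝ) (grp : ι → Fin p)
    (hf : ∀ i ∈ N, 0 < f i) (ha : ∀ i ∈ N, 0 < a i)
    (hqv : ∀ x, 0 < qv x) (hanti : StrictAnti qv)
    (hqual : ∀ i ∈ N, f i = qv (grp i) * a i)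
    (S S' : Finset ι) (hS : S ⊆ N) (hS' : S' ⊆ N)
    (hsh : ∀ x : Fin p,
      shareSum a (S.filter (fun i => grp i = x)) ≤
        shareSum a (S'.filter (fun i => grp i = x)))
    (hup : ∀ x : Fin p,
      shareSum a (uptoSet grp S x) ≤ shareSum a (uptoSet grp S' x))
    (hbp : ∀ x : Fin p,
      shareSum a (uptoSet grp S' x) ≤ balPt f a grp qv S' x) :
    gUtil f a S ≤ gUtil f a S' := by
  have hqS : ∀ i ∈ S, f i = qv (grp i) * a i := fun i hi => hqual i (hS hi)
  have hqS' : ∀ i ∈ S', f i = qv (grp i) * a i := fun i hi => hqual i (hS' hi)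
  refine gUtil_le_of_group_shares_le hqv hqS hqS' hsh fun x => ?_
  obtain _ | n := p
  · exact x.elim0
  have hlast := valSum_uptoSet_le_of_le_balPt (hqv (Fin.last n)) hqS' (hbp (Fin.last n))
  rw [uptoSet_last] at hlast
  have hF : 0 ≤ valSum f S' := Finset.sum_nonneg fun i hi => (hf i (hS' hi)).le
  have hA : 0 ≤ 1 - shareSum a S' := nonneg_of_mul_nonneg_right (hF.trans hlast) (hqv _)
  exact hlast.trans (mul_le_mul_of_nonneg_right (hanti.antitone (Fin.le_last x)) hA)
end

section
/- Let S, S′ ⊆ N be two sets of agents in the additive OMAC setup and let 1 ≤ y < p. Suppose that for every quality group Q_x with 1 ≤ x ≤ y, the shares satisfy α(S ∩ Q_x) ≤ α(S′ ∩ Q_x) and α(S^x) ≤ α((S′)^x) ≤ b(S′, x). Then g(S) ≤ sup_{s ≥ 0} (1 − α((S′)^y) − s)·(f((S′)^y) + s·q^{y+1}); that is, g(S) is at most the utility g((S′)^y ∪ {r}) obtained by adding to (S′)^y the auxiliary agent r of quality q^{y+1} whose share maximizes utility over the fixed set (S′)^y. -/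
open Finset

/-- AM-GM bound for the utility of a team extended by an agent of quality `c` and share `r`. -/
lemma four_mul_extend_utility_le_sq (A F c r : ℝ) :
    4 * (c * ((1 - A - r) * (F + c * r))) ≤ (c * (1 - A) + F) ^ 2 := by
  nlinarith [sq_nonneg (c * (1 - A - r) - (F + c * r))]

/-- A team of share `A` and value `F`, extended by share `r` of quality at most `Q`, is dominated
by a team of share `A'` and value `F'` together with some agent of quality `Q`. -/
lemma exists_share_extend_utility_ge {A F r R A' F' Q M : ℝ} (hQ : 0 < Q) (hQM : Q ≤ M)
    (hF : 0 ≤ F) (hr : 0 ≤ r) (hR : 0 ≤ R) (hRr : R ≤ Q * r) (hAA : A ≤ A') (hF' : 0 ≤ F')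
    (hdiff : M * (A' - A) ≤ F' - F) (hlow : M * A' ≤ F') (hbal : F' + M * A' ≤ M) :
    ∃ s, 0 ≤ s ∧ (1 - A - r) * (F + R) ≤ (1 - A' - s) * (F' + s * Q) := by
  have hM : 0 < M := hQ.trans_le hQM
  have hA' : A' < 1 := by nlinarith
  rcases le_total (1 - A - r) 0 with hneg | hpos
  · refine ⟨0, le_rfl, ?_⟩
    nlinarith [mul_nonneg (sub_nonneg.2 hA'.le) hF',
      mul_nonneg (neg_nonneg.2 hneg) (add_nonneg hF hR)]
  have key : ∀ c, Q ≤ c → c ≤ M →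
      4 * (c * ((1 - A - r) * (F + R))) ≤ (c * (1 - A') + F') ^ 2 := by
    intro c hQc hcM
    have hc : 0 < c := hQ.trans_le hQc
    have hRc : R ≤ c * r := hRr.trans (mul_le_mul_of_nonneg_right hQc hr)
    have hlin : c * (1 - A) + F ≤ c * (1 - A') + F' := by
      nlinarith [mul_le_mul_of_nonneg_right hcM (sub_nonneg.2 hAA)]
    have hnn : 0 ≤ c * (1 - A) + F := by
      have : 0 ≤ 1 - A := by linarith
      positivity
    calc 4 * (c * ((1 - A - r) * (F + R)))
        ≤ 4 * (c * ((1 - A - r) * (F + c * r))) := by gcongr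
      _ ≤ (c * (1 - A) + F) ^ 2 := four_mul_extend_utility_le_sq A F c r
      _ ≤ (c * (1 - A') + F') ^ 2 := by gcongr
  rcases le_total F' (Q * (1 - A')) with h | h
  · refine ⟨(1 - A' - F' / Q) / 2, ?_, ?_⟩
    · have : F' / Q ≤ 1 - A' := by rw [div_le_iff₀ hQ]; linarith
      linarith
    · have hopt : 4 * (Q * ((1 - A' - (1 - A' - F' / Q) / 2) *
          (F' + (1 - A' - F' / Q) / 2 * Q))) = (Q * (1 - A') + F') ^ 2 := by
        field_simp
        ring
      have := key Q le_rfl hQM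
      rw [← hopt] at this
      exact le_of_mul_le_mul_left (by linarith) hQ
  · refine ⟨0, le_rfl, ?_⟩
    have h1 : 0 < 1 - A' := by linarith
    have hQc : Q ≤ F' / (1 - A') := by rwa [le_div_iff₀ h1]
    have hcM : F' / (1 - A') ≤ M := by rw [div_le_iff₀ h1]; linarith
    have hk := key _ hQc hcM
    have hcF : F' / (1 - A') * (1 - A') = F' := div_mul_cancel₀ _ h1.ne'
    set c := F' / (1 - A')
    refine le_of_mul_le_mul_left ?_ (hQ.trans_le hQc)
    have : c * ((1 - A' - 0) * (F' + 0 * Q)) = F' * F' := by linear_combination F' * hcF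
    rw [hcF] at hk
    linarith

/-- The utilities obtained by adding an agent of positive quality `Q` are bounded above. -/
lemma bddAbove_extend_utility (A F : ℝ) {Q : ℝ} (hQ : 0 < Q) :
    BddAbove {u : ℝ | ∃ s : ℝ, 0 ≤ s ∧ u = (1 - A - s) * (F + s * Q)} := by
  refine ⟨(Q * (1 - A) + F) ^ 2 / (4 * Q), ?_⟩
  rintro u ⟨s, -, rfl⟩
  rw [le_div_iff₀ (by positivity)]
  linarith [four_mul_extend_utility_le_sq A F Q s]

/-- Sums weighted by a nonnegative function of the group compare if the group sums do. -/
lemma sum_group_weight_le {ι κ : Type*} [Fintype κ] [DecidableEq κ] (a : ι → ℝ) (w : κ → ℝ)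
    (grp : ι → κ) (S T : Finset ι) (hw : ∀ x, 0 ≤ w x)
    (h : ∀ x, w x ≠ 0 → ∑ i ∈ S with grp i = x, a i ≤ ∑ i ∈ T with grp i = x, a i) :
    ∑ i ∈ S, w (grp i) * a i ≤ ∑ i ∈ T, w (grp i) * a i := by
  have hfib (U : Finset ι) :
      ∑ i ∈ U, w (grp i) * a i = ∑ x, w x * ∑ i ∈ U with grp i = x, a i := by
    rw [← Finset.sum_fiberwise U grp]
    refine Finset.sum_congr rfl fun x _ => ?_
    rw [Finset.mul_sum]
    refine Finset.sum_congr rfl fun i hi => ?_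
    rw [(Finset.mem_filter.1 hi).2]
  rw [hfib, hfib]
  refine Finset.sum_le_sum fun x _ => ?_
  rcases eq_or_ne (w x) 0 with h0 | h0
  · simp [h0]
  · exact mul_le_mul_of_nonneg_left (h x h0) (hw x)

/-- Let `S, S′ ⊆ N` be two sets of agents in the additive OMAC setup
and let `1 ≤ y < p`. Suppose that for every quality group `Q_x` with `1 ≤ x ≤ y`,
the shares satisfy `α(S ∩ Q_x) ≤ α(S′ ∩ Q_x)` and `α(S^x) ≤ α((S′)^x) ≤ b(S′, x)`.
Then `g(S) ≤ sup_{s ≥ 0} (1 − α((S′)^y) − s)·(f((S′)^y) + s·q^{y+1})`; i.e. `g(S)`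
is at most the utility obtained by adding to `(S′)^y` the auxiliary agent of
quality `q^{y+1}` whose share maximizes utility over the fixed set `(S′)^y`. -/
theorem utility_comparison_with_auxiliary_agent {ι : Type} [DecidableEq ι]
    (N : Finset ι) (f a : ι → ℝ) (p : ℕ) (qv : Fin p → ℝ) (grp : ι → Fin p)
    (hf : ∀ i ∈ N, 0 < f i) (ha : ∀ i ∈ N, 0 < a i)
    (hqv : ∀ x, 0 < qv x) (hanti : StrictAnti qv)
    (hqual : ∀ i ∈ N, f i = qv (grp i) * a i)
    (S S' : Finset ι) (hS : S ⊆ N) (hS' : S' ⊆ N)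
    (y : Fin p) (hy : (y : ℕ) + 1 < p)
    (hsh : ∀ x : Fin p, x ≤ y →
      shareSum a (S.filter (fun i => grp i = x)) ≤
        shareSum a (S'.filter (fun i => grp i = x)))
    (hup : ∀ x : Fin p, x ≤ y →
      shareSum a (uptoSet grp S x) ≤ shareSum a (uptoSet grp S' x))
    (hbp : ∀ x : Fin p, x ≤ y →
      shareSum a (uptoSet grp S' x) ≤ balPt f a grp qv S' x) :
    gUtil f a S ≤ sSup {u : ℝ | ∃ s : ℝ, 0 ≤ s ∧
      u = (1 - shareSum a (uptoSet grp S' y) - s) *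
        (valSum f (uptoSet grp S' y) + s * qv ⟨(y : ℕ) + 1, hy⟩)} := by
  set z : Fin p := ⟨(y : ℕ) + 1, hy⟩ with hz
  have hyz : y < z := by simp [hz, Fin.lt_def]
  have hlow : qv y * shareSum a (uptoSet grp S' y) ≤ valSum f (uptoSet grp S' y) := by
    unfold shareSum valSum
    rw [Finset.mul_sum]
    refine Finset.sum_le_sum fun i hi => ?_
    obtain ⟨hi, hiy⟩ := Finset.mem_filter.1 hi
    rw [hqual i (hS' hi)]
    exact mul_le_mul_of_nonneg_right (hanti.antitone hiy) (ha i (hS' hi)).le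
  have hval' : 0 ≤ valSum f (uptoSet grp S' y) :=
    Finset.sum_nonneg fun i hi => (hf i (hS' (Finset.mem_filter.1 hi).1)).le
  have hbal : valSum f (uptoSet grp S' y) + qv y * shareSum a (uptoSet grp S' y) ≤ qv y := by
    have hsplit (v : ι → ℝ) : ∑ i ∈ uptoSet grp S' y, v i =
        ∑ i ∈ belowSet grp S' y, v i + ∑ i ∈ S' with grp i = y, v i := by
      unfold uptoSet belowSet
      rw [← Finset.sum_union]
      · congr 1
        ext i
        simp only [Finset.mem_filter, Finset.mem_union, le_iff_lt_or_eq]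
        tauto
      · exact Finset.disjoint_filter.2 fun i _ h h' => h.ne h'
    have hgroup : ∑ i ∈ S' with grp i = y, f i = qv y * ∑ i ∈ S' with grp i = y, a i := by
      rw [Finset.mul_sum]
      refine Finset.sum_congr rfl fun i hi => ?_
      obtain ⟨hiS, hiy⟩ := Finset.mem_filter.1 hi
      rw [hqual i (hS' hiS), hiy]
    have hb := mul_le_mul_of_nonneg_left (hbp y le_rfl) (hqv y).le
    unfold balPt at hb
    unfold shareSum valSum at *
    rw [hsplit f, hsplit a, hgroup]
    rw [hsplit a] at hb
    have : qv y * ((∑ i ∈ belowSet grp S' y, f i) / qv y) = ∑ i ∈ belowSet grp S' y, f i :=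
      mul_div_cancel₀ _ (hqv y).ne'
    linarith
  have hdiff : qv y * (shareSum a (uptoSet grp S' y) - shareSum a (uptoSet grp S y)) ≤
      valSum f (uptoSet grp S' y) - valSum f (uptoSet grp S y) := by
    have hexcess (U : Finset ι) (hU : U ⊆ N) :
        ∑ i ∈ U, max (qv (grp i) - qv y) 0 * a i =
          valSum f (uptoSet grp U y) - qv y * shareSum a (uptoSet grp U y) := by
      unfold valSum shareSum uptoSet
      rw [Finset.mul_sum, ← Finset.sum_sub_distrib, Finset.sum_filter]
      refine Finset.sum_congr rfl fun i hi => ?_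
      split_ifs with h
      · rw [max_eq_left (sub_nonneg.2 (hanti.antitone h)), hqual i (hU hi)]
        ring
      · rw [max_eq_right (sub_nonpos.2 (hanti (not_le.1 h)).le), zero_mul]
    have := sum_group_weight_le a (fun x => max (qv x - qv y) 0) grp S S'
      (fun x => le_max_right _ _) fun x hx => hsh x <| by
        contrapose! hx
        exact max_eq_right (sub_nonpos.2 (hanti hx).le)
    rw [hexcess S hS, hexcess S' hS'] at this
    linarith
  have hrest : ∑ i ∈ S with ¬ grp i ≤ y, f i ≤ qv z * ∑ i ∈ S with ¬ grp i ≤ y, a i := by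
    rw [Finset.mul_sum]
    refine Finset.sum_le_sum fun i hi => ?_
    obtain ⟨hi, hiy⟩ := Finset.mem_filter.1 hi
    rw [hqual i (hS hi)]
    refine mul_le_mul_of_nonneg_right (hanti.antitone ?_) (ha i (hS hi)).le
    exact Nat.succ_le_of_lt (not_le.1 hiy)
  have hnn (v : ι → ℝ) (hv : ∀ i ∈ N, 0 < v i) (P : ι → Prop) [DecidablePred P] :
      0 ≤ ∑ i ∈ S with P i, v i :=
    Finset.sum_nonneg fun i hi => (hv i (hS (Finset.mem_filter.1 hi).1)).le
  obtain ⟨s, hs, hle⟩ := exists_share_extend_utility_ge (hqv z) (hanti hyz).le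
    (hnn f hf (fun i => grp i ≤ y)) (hnn a ha (fun i => ¬ grp i ≤ y))
    (hnn f hf (fun i => ¬ grp i ≤ y)) hrest (hup y le_rfl) hval' hdiff hlow hbal
  have hg : gUtil f a S = (1 - shareSum a (uptoSet grp S y) - ∑ i ∈ S with ¬ grp i ≤ y, a i) *
      (∑ i ∈ S with grp i ≤ y, f i + ∑ i ∈ S with ¬ grp i ≤ y, f i) := by
    unfold gUtil shareSum valSum uptoSet
    rw [Finset.sum_filter_add_sum_filter_not, sub_sub, Finset.sum_filter_add_sum_filter_not]
  rw [hg]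
  exact hle.trans (le_csSup (bddAbove_extend_utility _ _ (hqv z)) ⟨s, hs, rfl⟩)
end

section
/- Let m, n ∈ ℕ with m ≥ 1 and n ≥ 1. Define real numbers A_h^ℓ for 1 ≤ h, ℓ ≤ m recursively by A_h^m = h/m, and A_h^ℓ = (1/n)·A_{h+1}^{ℓ+1} + ((n−1)/n)·A_h^{ℓ+1} for 1 ≤ ℓ < m (with the convention that the recursion only uses well-defined values, i.e., h + (m − ℓ) ≤ m in all terms reached from A_1^1; equivalently extend the definition A_h^m = h/m to all h ∈ ℕ). Then A_1^1 ≤ 1/n + 1/m. -/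
/-- Closed form of the recursion: `A_h^ℓ = (h + k/n)/m` when `k = m - ℓ` steps remain. -/
theorem recursion_closed_form {m n : ℕ} (hn : 1 ≤ n) {A : ℕ → ℕ → ℝ}
    (hbase : ∀ h : ℕ, A h m = (h : ℝ) / m)
    (hrec : ∀ h ℓ : ℕ, 1 ≤ ℓ → ℓ < m →
      A h ℓ = (1 / (n : ℝ)) * A (h + 1) (ℓ + 1) + (((n : ℝ) - 1) / n) * A h (ℓ + 1))
    (k h ℓ : ℕ) (hℓ : 1 ≤ ℓ) (hk : ℓ + k = m) :
    A h ℓ = ((h : ℝ) + k / n) / m := by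
  have hn0 : (n : ℝ) ≠ 0 := by positivity
  have hm0 : (m : ℝ) ≠ 0 := Nat.cast_ne_zero.mpr (by lia)
  induction k generalizing h ℓ with
  | zero =>
    obtain rfl : ℓ = m := hk
    simp [hbase]
  | succ k ih =>
    rw [hrec h ℓ hℓ (by lia), ih (h + 1) (ℓ + 1) (by lia) (by lia),
      ih h (ℓ + 1) (by lia) (by lia)]
    push_cast
    field_simp
    ring

/-- Let `m, n ∈ ℕ` with `m ≥ 1` and `n ≥ 1`. Define real numbers
`A_h^ℓ` by `A_h^m = h/m` (extended to all `h ∈ ℕ`) and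
`A_h^ℓ = (1/n)·A_{h+1}^{ℓ+1} + ((n−1)/n)·A_h^{ℓ+1}` for `1 ≤ ℓ < m`.
Then `A_1^1 ≤ 1/n + 1/m`. -/
theorem recursion_bound (m n : ℕ) (hm : 1 ≤ m) (hn : 1 ≤ n)
    (A : ℕ → ℕ → ℝ)
    (hbase : ∀ h : ℕ, A h m = (h : ℝ) / m)
    (hrec : ∀ h ℓ : ℕ, 1 ≤ ℓ → ℓ < m →
      A h ℓ = (1 / (n : ℝ)) * A (h + 1) (ℓ + 1) + (((n : ℝ) - 1) / n) * A h (ℓ + 1)) :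
    A 1 1 ≤ 1 / (n : ℝ) + 1 / (m : ℝ) := by
  have hn0 : (0 : ℝ) < n := by positivity
  have hm0 : (0 : ℝ) < m := by positivity
  rw [recursion_closed_form hn hbase hrec (m - 1) 1 1 le_rfl (by lia), Nat.cast_sub hm,
    add_comm (1 / (n : ℝ)), Nat.cast_one, add_div]
  refine add_le_add le_rfl ?_
  rw [div_div, div_le_div_iff₀ (by positivity) hn0]
  nlinarith
end

section
/- For every γ > 0 there exist n ∈ ℕ and positive reals (f_i)_{i=1}^n, (α_i)_{i=1}^n (an additive OMAC instance with agents arriving in order 1, …, n) such that: for every admissible online chain of hired sets S_0 = ∅, S_i ⊆ S_{i−1} ∪ {i} for 1 ≤ i ≤ n, there exists a prefix length k ∈ {1,…,n} with max_{T ⊆ {1,…,k}} g(T) > 0 and g(S_k) < γ · max_{T ⊆ {1,…,k}} g(T). In particular, no deterministic online algorithm with preemption for additive OMAC achieves competitive ratio γ. -/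
open Finset

/-- The first `k` agents (the length-`k` prefix of the arrival sequence). -/
def prefixSet (n k : ℕ) : Finset (Fin n) :=
  Finset.univ.filter (fun j : Fin n => (j : ℕ) < k)

/-- Sum over `S` of the weight that is `x` at `0` and `y` elsewhere. -/
theorem sum_ite_eq_zero_fin {N : ℕ} (x y : ℝ) (S : Finset (Fin (N + 1))) :
    ∑ i ∈ S, (if i = 0 then x else y) =
      (if (0 : Fin (N + 1)) ∈ S then x else 0) + y * ((S.erase 0).card : ℝ) := by
  have herase : ∑ i ∈ S.erase 0, (if i = 0 then x else y) = y * ((S.erase 0).card : ℝ) := by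
    rw [Finset.sum_congr rfl fun i hi => if_neg (Finset.ne_of_mem_erase hi)]
    simp [mul_comm]
  split_ifs with h
  · rw [← Finset.add_sum_erase S _ h, herase, if_pos rfl]
  · rw [← herase, Finset.erase_eq_of_notMem h, zero_add]

/-- Utility of a team that contains the large agent `0`. -/
theorem gUtil_of_zero_mem {N : ℕ} {d s v : ℝ} {S : Finset (Fin (N + 1))} (h : 0 ∈ S) :
    gUtil (fun i => if i = 0 then 1 else v) (fun i => if i = 0 then 1 - d else s) S =
      (d - s * ((S.erase 0).card : ℝ)) * (1 + v * ((S.erase 0).card : ℝ)) := by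
  simp only [gUtil, shareSum, valSum, sum_ite_eq_zero_fin, if_pos h]
  ring

/-- Utility of a team that does not contain the large agent `0`. -/
theorem gUtil_of_zero_notMem {N : ℕ} {d s v : ℝ} {S : Finset (Fin (N + 1))} (h : 0 ∉ S) :
    gUtil (fun i => if i = 0 then 1 else v) (fun i => if i = 0 then 1 - d else s) S =
      (1 - s * (S.card : ℝ)) * (v * (S.card : ℝ)) := by
  simp only [gUtil, shareSum, valSum, sum_ite_eq_zero_fin, if_neg h,
    Finset.erase_eq_of_notMem h]
  ring

/-- A chain that is `γ`-competitive against every team of every prefix cannot exist when one large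
agent of share `1 - d` and value `1` is followed by `N` small agents of share `s = 1 / (2N)` and
value `e * s`. -/
theorem not_competitive_large_then_small {N : ℕ} {γ d e s : ℝ} (hγ : 0 < γ) (hd : 0 < d)
    (he : 0 < e) (hs : 0 < s) (he1 : e ≤ 1) (hd1 : d ≤ 1) (hsd : s ≤ d) (hsN : s * N = 1 / 2)
    (heγ : 2 * e < γ) (hdγ : 8 * d < γ * e) (S : ℕ → Finset (Fin (N + 1))) (h0 : S 0 = ∅)
    (hS : ∀ (i : ℕ) (hi : i < N + 1), S (i + 1) ⊆ insert (⟨i, hi⟩ : Fin (N + 1)) (S i))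
    (hcomp : ∀ k, 1 ≤ k → k ≤ N + 1 → ∀ T ⊆ prefixSet (N + 1) k,
      0 < gUtil (fun i => if i = 0 then 1 else e * s) (fun i => if i = 0 then 1 - d else s) T →
      γ * gUtil (fun i => if i = 0 then 1 else e * s) (fun i => if i = 0 then 1 - d else s) T ≤
        gUtil (fun i => if i = 0 then 1 else e * s) (fun i => if i = 0 then 1 - d else s) (S k)) :
    False := by
  have hge : ∀ k, 1 ≤ k → k ≤ N + 1 → γ * d ≤
      gUtil (fun i => if i = 0 then 1 else e * s) (fun i => if i = 0 then 1 - d else s) (S k) := by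
    intro k hk hk'
    have hg : gUtil (fun i : Fin (N + 1) => if i = 0 then 1 else e * s)
        (fun i => if i = 0 then 1 - d else s) {0} = d := by
      rw [gUtil_of_zero_mem (by simp)]
      simp
    have hT : ({0} : Finset (Fin (N + 1))) ⊆ prefixSet (N + 1) k := by
      simp only [prefixSet, Finset.singleton_subset_iff, Finset.mem_filter, Finset.mem_univ,
        true_and, Fin.val_zero]
      omega
    simpa only [hg] using hcomp k hk hk' {0} hT (hg.symm ▸ hd)
  have hγd : 0 < γ * d := mul_pos hγ hd
  have hsmall : ∀ k, 1 ≤ k → k ≤ N + 1 → 0 ∈ S k → s * (((S k).erase 0).card : ℝ) < d := by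
    intro k hk hk' hmem
    have h := hγd.trans_le (hge k hk hk')
    rw [gUtil_of_zero_mem hmem] at h
    have := pos_of_mul_pos_left h (by positivity)
    linarith
  have hmem : ∀ k, 1 ≤ k → k ≤ N + 1 → 0 ∈ S k := by
    intro k hk
    induction k, hk using Nat.le_induction with
    | base =>
      intro hk'
      by_contra hnot
      have hsub := hS 0 (by omega)
      have hempty : S 1 = ∅ := by
        refine Finset.eq_empty_of_forall_notMem fun x hx => ?_
        have hx0 := hsub hx
        rw [h0] at hx0
        have : x = 0 := by simpa using hx0
        exact hnot (this ▸ hx)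
      have h := hge 1 le_rfl hk'
      rw [gUtil_of_zero_notMem hnot, hempty] at h
      simp at h
      linarith
    | succ k hk ih =>
      intro hk'
      by_contra hnot
      have hcard : (S (k + 1)).card ≤ ((S k).erase 0).card + 1 := by
        refine (Finset.card_le_card fun x hx => ?_).trans
          (Finset.card_insert_le (⟨k, by omega⟩ : Fin (N + 1)) _)
        have hx0 : x ≠ 0 := fun h => hnot (h ▸ hx)
        have := hS k (by omega) hx
        simp only [Finset.mem_insert, Finset.mem_erase] at this ⊢
        tauto
      have hcard' : ((S (k + 1)).card : ℝ) ≤ (((S k).erase 0).card : ℝ) + 1 := by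
        exact_mod_cast hcard
      have hlt := hsmall k hk (by omega) (ih (by omega))
      have h := hge (k + 1) (by omega) hk'
      rw [gUtil_of_zero_notMem hnot, mul_assoc e s] at h
      have hsc : s * ((S (k + 1)).card : ℝ) ≤ 2 * d := by
        have := mul_le_mul_of_nonneg_left hcard' hs.le
        linarith
      have hsc0 : 0 ≤ s * ((S (k + 1)).card : ℝ) := by positivity
      generalize s * ((S (k + 1)).card : ℝ) = t at *
      have hle : (1 - t) * (e * t) ≤ e * (2 * d) := by
        nlinarith [mul_nonneg he.le (mul_nonneg hsc0 hsc0), mul_le_mul_of_nonneg_left hsc he.le]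
      have := mul_lt_mul_of_pos_right heγ hd
      linarith
  have hlast := hmem (N + 1) (by omega) le_rfl
  have hlt := hsmall (N + 1) (by omega) le_rfl hlast
  have hg : gUtil (fun i : Fin (N + 1) => if i = 0 then 1 else e * s)
      (fun i => if i = 0 then 1 - d else s) (Finset.univ.erase 0) = e / 4 := by
    rw [gUtil_of_zero_notMem (by simp), Finset.card_erase_of_mem (Finset.mem_univ _)]
    simp only [Finset.card_univ, Fintype.card_fin, Nat.add_sub_cancel, mul_assoc, hsN]
    ring
  have h := hcomp (N + 1) (by omega) le_rfl (Finset.univ.erase 0)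
    (fun x _ => by simp [prefixSet]; omega) (by rw [hg]; positivity)
  rw [hg, gUtil_of_zero_mem hlast, mul_assoc e s] at h
  have hsc0 : 0 ≤ s * (((S (N + 1)).erase 0).card : ℝ) := by positivity
  generalize s * (((S (N + 1)).erase 0).card : ℝ) = t at *
  have het : e * t ≤ 1 := mul_le_one₀ he1 hsc0 (by linarith)
  have : (d - t) * (1 + e * t) ≤ d * 2 :=
    mul_le_mul (by linarith) (by linarith) (by positivity) hd.le
  linarith

/-- For every `γ > 0` there exists an additive OMAC instance
(agents `1, …, n` arriving in this order, with positive values and shares) such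
that for every admissible online chain of hired sets `S_0 = ∅`,
`S_i ⊆ S_{i−1} ∪ {i}`, there exists a prefix length `k ∈ {1,…,n}` with
`max_{T ⊆ {1,…,k}} g(T) > 0` and `g(S_k) < γ · max_{T ⊆ {1,…,k}} g(T)`.
In particular, no deterministic online algorithm with preemption for additive
OMAC achieves competitive ratio `γ`. -/
theorem no_deterministic_constant_CR (γ : ℝ) (hγ : 0 < γ) :
    ∃ (n : ℕ) (f a : Fin n → ℝ),
      (∀ i, 0 < f i) ∧ (∀ i, 0 < a i) ∧
      ∀ S : ℕ → Finset (Fin n),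
        S 0 = ∅ →
        (∀ (i : ℕ) (hi : i < n), S (i + 1) ⊆ insert (⟨i, hi⟩ : Fin n) (S i)) →
        ∃ k : ℕ, 1 ≤ k ∧ k ≤ n ∧
          ∃ Topt ⊆ prefixSet n k,
            (∀ T ⊆ prefixSet n k, gUtil f a T ≤ gUtil f a Topt) ∧
            0 < gUtil f a Topt ∧
            gUtil f a (S k) < γ * gUtil f a Topt := by
  obtain ⟨c, hc, hc1, hcγ⟩ : ∃ c : ℝ, 0 < c ∧ c ≤ 1 ∧ c ≤ γ :=
    ⟨min γ 1, lt_min hγ one_pos, min_le_right _ _, min_le_left _ _⟩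
  have hd : 0 < c ^ 2 / 64 := by positivity
  have hd1 : c ^ 2 / 64 < 1 := by nlinarith
  obtain ⟨N, hN⟩ := exists_nat_gt (1 / (2 * (c ^ 2 / 64)))
  have hN0 : (0 : ℝ) < N := lt_trans (by positivity) hN
  have hs : (0 : ℝ) < 1 / (2 * N) := by positivity
  refine ⟨N + 1, fun i => if i = 0 then 1 else c / 4 * (1 / (2 * N)),
    fun i => if i = 0 then 1 - c ^ 2 / 64 else 1 / (2 * N), ?_, ?_, ?_⟩
  · intro i
    dsimp only
    split_ifs <;> positivity
  · intro i
    dsimp only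
    split_ifs
    · linarith
    · positivity
  intro S h0 hS
  by_contra! hcon
  refine not_competitive_large_then_small (γ := c) hc hd (by positivity : 0 < c / 4) hs
    (by linarith) hd1.le ?_ (by field_simp) (by linarith) (by nlinarith) S h0 hS ?_
  · rw [div_lt_iff₀ (by positivity)] at hN
    rw [div_le_iff₀ (by positivity)]
    linarith
  · intro k hk hk' T hT hpos
    obtain ⟨M, hM, hmax⟩ := Finset.exists_max_image (prefixSet (N + 1) k).powerset
      (gUtil (fun i => if i = 0 then 1 else c / 4 * (1 / (2 * N)))
        (fun i => if i = 0 then 1 - c ^ 2 / 64 else 1 / (2 * N)))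
      ⟨∅, Finset.empty_mem_powerset _⟩
    have hTM := hmax T (Finset.mem_powerset.2 hT)
    refine le_trans ?_ (hcon k hk hk' M (Finset.mem_powerset.1 hM)
      (fun T' hT' => hmax T' (Finset.mem_powerset.2 hT')) (hpos.trans_le hTM))
    exact mul_le_mul hcγ hTM hpos.le hγ.le
end

section
/- Fix a quality q > 0, an integer n ≥ 1 and ε ∈ (0, 1/2). Consider the additive OMAC instance of n agents arriving in order 1, …, n with shares α_i = 1 − ε^{n−i+1} and values f_i = q·α_i (so every agent has quality q). Then for every dismiss-free (no-preemption) chain of hired sets S_0 = ∅ and S_{i−1} ⊆ S_i ⊆ S_{i−1} ∪ {i} for 1 ≤ i ≤ n, the average competitive ratio over prefixes satisfies (1/n)·Σ_{i=1}^n g(S_i)/OPT_i ≤ 1/n + 4ε, where OPT_i = max_{T ⊆ {1,…,i}} g(T) > 0. In particular, without preemption the competitive ratio of any algorithm on uniform-quality instances is O(1/n). -/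
open Finset

/-- `OPT_k`: the optimal offline utility on the length-`k` prefix,
`max_{T ⊆ {1,…,k}} g(T)`. -/
noncomputable def OPTpre {n : ℕ} (f a : Fin n → ℝ) (k : ℕ) : ℝ :=
  ((prefixSet n k).powerset).sup' ⟨∅, Finset.empty_mem_powerset _⟩ (gUtil f a)

/-- If every share is at least `1/2`, a team of two or more agents has nonpositive utility. -/
theorem gUtil_nonpos_of_nontrivial {ι : Type} {f a : ι → ℝ} (ha : ∀ i, 1 / 2 ≤ a i)
    (hf : ∀ i, 0 ≤ f i) {S : Finset ι} (hS : S.Nontrivial) : gUtil f a S ≤ 0 := by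
  have hcard : (2 : ℝ) ≤ S.card := by exact_mod_cast Finset.one_lt_card_iff_nontrivial.2 hS
  have hshare : (S.card : ℝ) * (1 / 2) ≤ shareSum a S := by
    rw [← nsmul_eq_mul]
    exact Finset.card_nsmul_le_sum S a _ fun i _ => ha i
  exact mul_nonpos_of_nonpos_of_nonneg (by linarith) (Finset.sum_nonneg fun i _ => hf i)

theorem gUtil_singleton {ι : Type} (f a : ι → ℝ) (i : ι) : gUtil f a {i} = (1 - a i) * f i := by
  simp [gUtil, shareSum, valSum]

theorem gUtil_le_OPTpre {n : ℕ} (f a : Fin n → ℝ) {k : ℕ} {T : Finset (Fin n)}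
    (hT : T ⊆ prefixSet n k) : gUtil f a T ≤ OPTpre f a k :=
  Finset.le_sup' (gUtil f a) (Finset.mem_powerset.2 hT)

/-- A hired set contains only agents that have already arrived. -/
theorem subset_prefixSet_of_step {n : ℕ} {S : ℕ → Finset (Fin n)} (h0 : S 0 = ∅)
    (hstep : ∀ (i : ℕ) (hi : i < n), S (i + 1) ⊆ insert (⟨i, hi⟩ : Fin n) (S i))
    {k : ℕ} (hk : k ≤ n) : S k ⊆ prefixSet n k := by
  induction k with
  | zero => simp [h0]
  | succ k ih =>
    intro j hj
    rcases Finset.mem_insert.1 (hstep k hk hj) with rfl | h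
    · simp [prefixSet]
    · have := ih (by omega) h
      simp only [prefixSet, Finset.mem_filter, Finset.mem_univ, true_and] at this ⊢
      omega

theorem subset_of_le_of_step {α : Type} {n : ℕ} {S : ℕ → Finset α}
    (hmono : ∀ i : ℕ, i < n → S i ⊆ S (i + 1)) {i k : ℕ} (hik : i ≤ k) (hk : k ≤ n) :
    S i ⊆ S k := by
  induction k, hik using Nat.le_induction with
  | base => exact subset_rfl
  | succ k _ ih => exact (ih (by omega)).trans (hmono k hk)

/-- Fix a quality `q > 0`, an integer `n ≥ 1` and `ε ∈ (0, 1/2)`.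
Consider the additive OMAC instance of `n` agents arriving in order `1, …, n`
with shares `α_i = 1 − ε^{n−i+1}` and values `f_i = q·α_i` (so every agent has
quality `q`). Then for every dismiss-free (no-preemption) chain of hired sets
`S_0 = ∅`, `S_{i−1} ⊆ S_i ⊆ S_{i−1} ∪ {i}`, the average competitive ratio over
prefixes satisfies `(1/n)·Σ_{i=1}^n g(S_i)/OPT_i ≤ 1/n + 4ε`, where
`OPT_i = max_{T ⊆ {1,…,i}} g(T) > 0`. In particular, without preemption the
competitive ratio of any algorithm on uniform-quality instances is `O(1/n)`.

(Agent `i ∈ {1,…,n}` is represented by the index `j = i − 1 : Fin n`, so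
`α_j = 1 − ε^{n−j}`.) -/
theorem dismiss_free_average_CR_bound (q : ℝ) (hq : 0 < q)
    (n : ℕ) (hn : 1 ≤ n) (ε : ℝ) (hε0 : 0 < ε) (hε2 : ε < 1 / 2)
    (f a : Fin n → ℝ)
    (hadef : ∀ j : Fin n, a j = 1 - ε ^ (n - (j : ℕ)))
    (hfdef : ∀ j : Fin n, f j = q * a j)
    (S : ℕ → Finset (Fin n))
    (h0 : S 0 = ∅)
    (hmono : ∀ i : ℕ, i < n → S i ⊆ S (i + 1))
    (hstep : ∀ (i : ℕ) (hi : i < n), S (i + 1) ⊆ insert (⟨i, hi⟩ : Fin n) (S i)) :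
    (∀ k ∈ Finset.Icc 1 n, 0 < OPTpre f a k) ∧
      (1 / (n : ℝ)) * ∑ k ∈ Finset.Icc 1 n, gUtil f a (S k) / OPTpre f a k ≤
        1 / (n : ℝ) + 4 * ε := by
  classical
  have hpow : ∀ j : Fin n, 0 < ε ^ (n - (j : ℕ)) ∧ ε ^ (n - (j : ℕ)) ≤ ε := fun j =>
    ⟨pow_pos hε0 _, pow_le_of_le_one hε0.le (by linarith) (by omega)⟩
  have ha : ∀ j, 1 / 2 ≤ a j := fun j => by
    rw [hadef]
    linarith [(hpow j).2]
  have ha1 : ∀ j, a j ≤ 1 := fun j => by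
    rw [hadef]
    linarith [(hpow j).1]
  have hf : ∀ j, 0 < f j := fun j => by
    rw [hfdef]
    exact mul_pos hq (by linarith [ha j])
  have hg : ∀ j, gUtil f a {j} = ε ^ (n - (j : ℕ)) * (q * a j) := fun j => by
    rw [gUtil_singleton, hfdef, hadef]
    ring
  have hgpos : ∀ j, 0 < gUtil f a {j} := fun j => by
    rw [hg, ← hfdef]
    exact mul_pos (hpow j).1 (hf j)
  have hlast : ∀ (k : ℕ) (hk : k < n), gUtil f a {⟨k, hk⟩} ≤ OPTpre f a (k + 1) := fun k hk =>
    gUtil_le_OPTpre f a (by simp [prefixSet])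
  have hopt : ∀ (k : ℕ), k < n → 0 < OPTpre f a (k + 1) := fun k hk =>
    (hgpos _).trans_le (hlast k hk)
  have hsub : ∀ {k : ℕ}, k ≤ n → S k ⊆ prefixSet n k := fun hk =>
    subset_prefixSet_of_step h0 hstep hk
  let P : ℕ → Prop := fun k => ∃ h : k < n, S (k + 1) = {⟨k, h⟩}
  have hterm : ∀ k ∈ Finset.range n, gUtil f a (S (k + 1)) / OPTpre f a (k + 1) ≤
      (if P k then 1 else 0) + 2 * ε := by
    intro k hk
    have hkn := Finset.mem_range.1 hk
    have hO := hopt k hkn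
    have hind : (0 : ℝ) ≤ if P k then 1 else 0 := by split_ifs <;> norm_num
    rcases (S (k + 1)).eq_empty_or_nonempty with hS | hS
    · have : gUtil f a (S (k + 1)) = 0 := by simp [hS, gUtil, valSum]
      rw [this, zero_div]
      linarith
    rcases hS.exists_eq_singleton_or_nontrivial with ⟨j, hj⟩ | hS
    · have hjk : (j : ℕ) < k + 1 := by
        have : j ∈ prefixSet n (k + 1) := hsub hkn (by simp [hj])
        simpa [prefixSet] using this
      by_cases hjk' : (j : ℕ) = k
      · have hP : P k := ⟨hkn, by rw [hj]; congr 1; exact Fin.ext hjk'⟩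
        have : gUtil f a (S (k + 1)) / OPTpre f a (k + 1) ≤ 1 :=
          (div_le_one hO).2 (gUtil_le_OPTpre f a (hsub hkn))
        rw [if_pos hP]
        linarith
      · suffices gUtil f a (S (k + 1)) / OPTpre f a (k + 1) ≤ 2 * ε by linarith
        rw [div_le_iff₀ hO]
        refine le_trans ?_ (mul_le_mul_of_nonneg_left (hlast k hkn) (by linarith))
        rw [hj, hg, hg]
        have hpk : ε ^ (n - (j : ℕ)) ≤ ε * ε ^ (n - k) := by
          rw [← pow_succ']
          exact pow_le_pow_of_le_one hε0.le (by linarith) (by omega)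
        have haj : q * a j ≤ 2 * (q * a ⟨k, hkn⟩) := by
          nlinarith [ha1 j, ha ⟨k, hkn⟩]
        calc ε ^ (n - (j : ℕ)) * (q * a j)
            ≤ (ε * ε ^ (n - k)) * (2 * (q * a ⟨k, hkn⟩)) :=
              mul_le_mul hpk haj (by rw [← hfdef]; exact (hf j).le) (by positivity)
          _ = 2 * ε * (ε ^ (n - k) * (q * a ⟨k, hkn⟩)) := by ring
    · have := div_nonpos_of_nonpos_of_nonneg
        (gUtil_nonpos_of_nontrivial ha (fun i => (hf i).le) hS) hO.le
      linarith
  have hcard : ((Finset.range n).filter P).card ≤ 1 := by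
    have key : ∀ i k, i < k → P i → P k → False := by
      rintro i k hik ⟨hi, hSi⟩ ⟨hk, hSk⟩
      have h : (⟨i, hi⟩ : Fin n) ∈ S (k + 1) :=
        subset_of_le_of_step hmono (by omega : i + 1 ≤ k + 1) hk (by simp [hSi])
      rw [hSk, Finset.mem_singleton, Fin.mk.injEq] at h
      omega
    refine Finset.card_le_one.2 fun i hi k hk => ?_
    have hPi := (Finset.mem_filter.1 hi).2
    have hPk := (Finset.mem_filter.1 hk).2
    rcases lt_trichotomy i k with h | h | h
    · exact (key i k h hPi hPk).elim
    · exact h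
    · exact (key k i h hPk hPi).elim
  have hn0 : (0 : ℝ) < n := by exact_mod_cast hn
  refine ⟨fun k hk => ?_, ?_⟩
  · obtain ⟨h1, h2⟩ := Finset.mem_Icc.1 hk
    obtain ⟨m, rfl⟩ := Nat.exists_eq_add_of_le' h1
    exact hopt m h2
  · have hsum : ∑ k ∈ Finset.Icc 1 n, gUtil f a (S k) / OPTpre f a k ≤ 1 + n * (2 * ε) := by
      rw [← Finset.Ico_add_one_right_eq_Icc, Finset.sum_Ico_eq_sum_range, Nat.add_sub_cancel]
      simp only [add_comm 1]
      refine (Finset.sum_le_sum hterm).trans ?_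
      rw [Finset.sum_add_distrib, Finset.sum_boole, Finset.sum_const, Finset.card_range,
        nsmul_eq_mul]
      have : (((Finset.range n).filter P).card : ℝ) ≤ 1 := by exact_mod_cast hcard
      linarith
    calc (1 / (n : ℝ)) * ∑ k ∈ Finset.Icc 1 n, gUtil f a (S k) / OPTpre f a k
        ≤ (1 / (n : ℝ)) * (1 + n * (2 * ε)) := by gcongr
      _ = 1 / (n : ℝ) + 2 * ε := by field_simp
      _ ≤ 1 / (n : ℝ) + 4 * ε := by linarith
end

section
/- Let E be a finite set of items, where each item e ∈ E has profit p_e > 0 and cost c_e > 0, and write p(S) = Σ_{e∈S} p_e and c(S) = Σ_{e∈S} c_e for S ⊆ E. Sort the items of E in nonincreasing order of quality p_e/c_e, and let G ⊆ E be the longest prefix of this sorted order with c(G) ≤ 1/2 (the greedy set at budget 1/2). Let S* ⊆ E be any subset maximizing the principal's utility (1 − c(S))·p(S) over all subsets S ⊆ E. Then p(S*) ≤ p(G) + max_{e ∈ E} p_e. -/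
open Finset

/-- A set containing exactly the nonnegative terms (up to terms equal to zero) has the largest
sum. -/
theorem sum_le_sum_of_nonneg_of_nonpos {ι : Type*} [DecidableEq ι] {d : ι → ℝ} {S A : Finset ι}
    (hA : ∀ e ∈ A, 0 ≤ d e) (hS : ∀ e ∈ S, e ∉ A → d e ≤ 0) :
    ∑ e ∈ S, d e ≤ ∑ e ∈ A, d e := by
  rw [← Finset.sum_inter_add_sum_sdiff S A d]
  have h₁ : ∑ e ∈ S ∩ A, d e ≤ ∑ e ∈ A, d e :=
    Finset.sum_le_sum_of_subset_of_nonneg Finset.inter_subset_right fun e he _ => hA e he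
  have h₂ : ∑ e ∈ S \ A, d e ≤ 0 := Finset.sum_nonpos fun e he =>
    hS e (Finset.mem_sdiff.1 he).1 (Finset.mem_sdiff.1 he).2
  linarith

/-- If a team of cost `x > 1/2` has density at least `ρ`, and a team of cost `y ≤ 1` with at least
the same utility gains at most `ρ` per unit of additional cost, then it has no larger reward. -/
theorem reward_le_of_utility_le {a b x y ρ : ℝ} (ha : 0 < a) (hρ : 0 ≤ ρ) (hx : 1 / 2 < x)
    (hy : y ≤ 1) (hdens : ρ * x ≤ a) (hgain : b - a ≤ ρ * (y - x))
    (hutil : (1 - x) * a ≤ (1 - y) * b) : b ≤ a := by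
  by_contra! hab
  have hxy : x < y := by
    by_contra! h
    have := mul_nonneg hρ (sub_nonneg.2 h)
    linarith
  have hbx : b * x ≤ a * y := by
    nlinarith [mul_le_mul_of_nonneg_right hdens (sub_nonneg.2 hxy.le)]
  have h₁ : (1 - y) * (b * x) ≤ (1 - y) * (a * y) :=
    mul_le_mul_of_nonneg_left hbx (by linarith)
  have h₂ : (1 - x) * a * x ≤ (1 - y) * b * x :=
    mul_le_mul_of_nonneg_right hutil (by linarith)
  have h₃ : 0 < a * ((y - x) * (x + y - 1)) :=
    mul_pos ha (mul_pos (by linarith) (by linarith))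
  linarith

/-- Let `E` be a finite set of items, where each item `e ∈ E` has
profit `p_e > 0` and cost `c_e > 0`, and write `p(S) = Σ_{e∈S} p_e` and
`c(S) = Σ_{e∈S} c_e`. Sort the items of `E` in nonincreasing order of quality
`p_e/c_e`, and let `G ⊆ E` be the longest prefix of this sorted order with
`c(G) ≤ 1/2` (the greedy set at budget `1/2`). Let `S* ⊆ E` be any subset
maximizing the principal's utility `(1 − c(S))·p(S)` over all subsets `S ⊆ E`.
Then `p(S*) ≤ p(G) + max_{e ∈ E} p_e`.

The sorted order is represented by a list `L` enumerating `E`, pairwise sorted in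
nonincreasing order of `p_e/c_e`; `G` is the length-`k` prefix, which is maximal
with cost `≤ 1/2` (either `k = |E|` or the `(k+1)`-prefix exceeds the budget). -/
theorem greedy_plus_max_profit_bound {ι : Type} [DecidableEq ι]
    (E : Finset ι) (hE : E.Nonempty)
    (p c : ι → ℝ) (hp : ∀ e ∈ E, 0 < p e) (hc : ∀ e ∈ E, 0 < c e)
    (L : List ι) (hnd : L.Nodup) (hLE : L.toFinset = E)
    (hsort : L.Pairwise (fun e e' => p e' / c e' ≤ p e / c e))
    (k : ℕ) (hk : k ≤ L.length)
    (G : Finset ι) (hG : G = (L.take k).toFinset)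
    (hGbudget : ∑ e ∈ G, c e ≤ 1 / 2)
    (hGmax : k = L.length ∨ 1 / 2 < ∑ e ∈ (L.take (k + 1)).toFinset, c e)
    (Sstar : Finset ι) (hSsub : Sstar ⊆ E)
    (hSopt : ∀ T ⊆ E,
      (1 - ∑ e ∈ T, c e) * ∑ e ∈ T, p e ≤
        (1 - ∑ e ∈ Sstar, c e) * ∑ e ∈ Sstar, p e) :
    ∑ e ∈ Sstar, p e ≤ (∑ e ∈ G, p e) + E.sup' hE p := by
  rcases hGmax with rfl | hcost
  · obtain rfl : G = E := by rw [hG, List.take_length, hLE]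
    have h₁ : ∑ e ∈ Sstar, p e ≤ ∑ e ∈ G, p e :=
      Finset.sum_le_sum_of_subset_of_nonneg hSsub fun e he _ => (hp e he).le
    obtain ⟨e, he⟩ := hE
    have h₂ := Finset.le_sup' p he
    linarith [hp e he]
  rcases hk.eq_or_lt with rfl | hlt
  · rw [List.take_of_length_le (Nat.le_succ _)] at hcost
    rw [hG, List.take_length] at hGbudget
    linarith
  set g := L[k] with hg
  have hL : L = L.take k ++ g :: L.drop (k + 1) := by
    rw [hg, List.getElem_cons_drop, List.take_append_drop]
  have hA : (L.take (k + 1)).toFinset = insert g G := by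
    ext e
    rw [List.take_succ_eq_append_getElem hlt, hG, List.mem_toFinset, List.mem_append,
      List.mem_singleton, Finset.mem_insert, List.mem_toFinset, or_comm]
  rw [hA] at hcost
  have hgE : g ∈ E := by simp [← hLE, hg]
  have hGE : G ⊆ E := by
    intro e he
    rw [hG, List.mem_toFinset] at he
    rw [← hLE, List.mem_toFinset]
    exact List.mem_of_mem_take he
  have hAE : insert g G ⊆ E := Finset.insert_subset hgE hGE
  have hgG : g ∉ G := by
    rw [hL] at hnd
    rw [hG, List.mem_toFinset]
    intro h
    exact (List.nodup_append.1 hnd).2.2 g h g List.mem_cons_self rfl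
  rw [hL, List.pairwise_append, List.pairwise_cons] at hsort
  obtain ⟨-, ⟨hafter, -⟩, hbefore⟩ := hsort
  set ρ := p g / c g with hρ
  have hnonneg : ∀ e ∈ insert g G, 0 ≤ p e - ρ * c e := by
    intro e he
    have hce := hc e (hAE he)
    rw [sub_nonneg, ← le_div_iff₀ hce]
    rcases Finset.mem_insert.1 he with rfl | he
    · exact le_rfl
    · rw [hG, List.mem_toFinset] at he
      exact hbefore e he g List.mem_cons_self
  have hnonpos : ∀ e ∈ Sstar, e ∉ insert g G → p e - ρ * c e ≤ 0 := by
    intro e he heA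
    rw [sub_nonpos, ← div_le_iff₀ (hc e (hSsub he))]
    refine hafter e ?_
    have heL := hSsub he
    rw [← hLE, List.mem_toFinset, hL, List.mem_append, List.mem_cons] at heL
    rw [Finset.mem_insert, hG, List.mem_toFinset] at heA
    tauto
  have hcmp := sum_le_sum_of_nonneg_of_nonpos hnonneg hnonpos
  have hdens := Finset.sum_nonneg hnonneg
  simp only [Finset.sum_sub_distrib, ← Finset.mul_sum] at hcmp hdens
  have hapos : 0 < ∑ e ∈ insert g G, p e :=
    Finset.sum_pos (fun e he => hp e (hAE he)) (Finset.insert_nonempty g G)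
  have hmain : ∑ e ∈ Sstar, p e ≤ ∑ e ∈ insert g G, p e := by
    rcases Sstar.eq_empty_or_nonempty with rfl | hne
    · simpa using hapos.le
    have hbpos : 0 < ∑ e ∈ Sstar, p e := Finset.sum_pos (fun e he => hp e (hSsub he)) hne
    have hempty := hSopt ∅ (Finset.empty_subset E)
    rw [Finset.sum_empty, Finset.sum_empty, mul_zero] at hempty
    have hy : ∑ e ∈ Sstar, c e ≤ 1 := sub_nonneg.1 (nonneg_of_mul_nonneg_left hempty hbpos)
    exact reward_le_of_utility_le hapos (div_pos (hp g hgE) (hc g hgE)).le hcost hy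
      (by linarith) (by linarith) (hSopt _ hAE)
  rw [Finset.sum_insert hgG] at hmain
  linarith [Finset.le_sup' p hgE]
end
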